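/- Let N = M and c ∈ Sym⁰_N. Suppose that for k = 1,…,K we have distinct pairs of marginals (μ^(k),ν^(k)) ∈ Δ_N × Δ_N, plans π^(k) ∈ OPT_c(μ^(k),ν^(k)), and extreme points u^(1,k),…,u^(L_k,k) ∈ EP(μ^(k),ν^(k)) representing π^(k). (a) If dim span{T(π^(k) − u^(ℓ,k)) : ℓ ∈ {1,…,L_k}, k ∈ {1,…,K}} = N(N−1)/2 − S for some S ∈ ℕ₀, then there exist S linearly independent matrices w_1,…,w_S ∈ Sym⁰_N such that every c' ∈ Sym⁰_N with π^(k) ∈ OPT_{c'}(μ^(k),ν^(k)) for all k satisfies c' − c ∈ span{w_1,…,w_S}. (b) Conversely, if the convex hull of {u^(ℓ,k) : ℓ} equals OPT_c(μ^(k),ν^(k)) for every k and dim span{T(π^(k) − u^(ℓ,k)) : ℓ, k} < N(N−1)/2 − S, then for every choice of S matrices w_1,…,w_S ∈ Sym⁰_N there exists c' ∈ Sym⁰_N with π^(k) ∈ OPT_{c'}(μ^(k),ν^(k)) for all k and c' − c ∉ span{w_1,…,w_S}. -/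

import Mathlib

open Finset

noncomputable section

/-- Frobenius inner product of two `N × N` real matrices. -/
def frob {N : ℕ} (c π : Matrix (Fin N) (Fin N) ℝ) : ℝ := ∑ i, ∑ j, c i j * π i j

/-- The set `Π(μ,ν)` of transport plans between `μ` and `ν`. -/
def Plans {N : ℕ} (μ ν : Fin N → ℝ) : Set (Matrix (Fin N) (Fin N) ℝ) :=
  {π | (∀ i j, 0 ≤ π i j) ∧ (∀ i, ∑ j, π i j = μ i) ∧ (∀ j, ∑ i, π i j = ν j)}

/-- The optimal transport cost `OT_c(μ,ν)`. -/
def OTcost {N : ℕ} (c : Matrix (Fin N) (Fin N) ℝ) (μ ν : Fin N → ℝ) : ℝ :=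
  sInf (frob c '' Plans μ ν)

/-- The set `OPT_c(μ,ν)` of optimal transport plans. -/
def OPT {N : ℕ} (c : Matrix (Fin N) (Fin N) ℝ) (μ ν : Fin N → ℝ) :
    Set (Matrix (Fin N) (Fin N) ℝ) :=
  {π ∈ Plans μ ν | frob c π = OTcost c μ ν}

/-- The set `EP(μ,ν)` of extreme points of the transport polytope. -/
def EP {N : ℕ} (μ ν : Fin N → ℝ) : Set (Matrix (Fin N) (Fin N) ℝ) :=
  Set.extremePoints ℝ (Plans μ ν)

/-- Symmetric matrices with zero diagonal. -/
def Sym0 (N : ℕ) : Set (Matrix (Fin N) (Fin N) ℝ) :=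
  {c | (∀ i, c i i = 0) ∧ ∀ i j, c i j = c j i}

/-- The symmetrized upper-triangular part: `T(π) = (π_{i,j} + π_{j,i})_{i<j}`. -/
def T {N : ℕ} (π : Matrix (Fin N) (Fin N) ℝ) : {p : Fin N × Fin N // p.1 < p.2} → ℝ :=
  fun p => π p.1.1 p.1.2 + π p.1.2 p.1.1

section

variable {N : ℕ}

/-- The Frobenius inner product as a bilinear map. -/
def frobForm (N : ℕ) :
    Matrix (Fin N) (Fin N) ℝ →ₗ[ℝ] Matrix (Fin N) (Fin N) ℝ →ₗ[ℝ] ℝ :=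
  LinearMap.mk₂ ℝ frob
    (fun a b p => by simp [frob, add_mul, Finset.sum_add_distrib])
    (fun t a p => by simp [frob, mul_assoc, Finset.mul_sum])
    (fun a p q => by simp [frob, mul_add, Finset.sum_add_distrib])
    (fun t a p => by simp [frob, mul_left_comm, Finset.mul_sum])

theorem frobForm_apply (c p : Matrix (Fin N) (Fin N) ℝ) : frobForm N c p = frob c p := rfl

/-- The symmetric matrix with zero diagonal and prescribed strictly upper triangular part. -/
def symMat (N : ℕ) :
    ({p : Fin N × Fin N // p.1 < p.2} → ℝ) →ₗ[ℝ] Matrix (Fin N) (Fin N) ℝ where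
  toFun x := Matrix.of fun i j =>
    if h : i < j then x ⟨(i, j), h⟩ else if h : j < i then x ⟨(j, i), h⟩ else 0
  map_add' x y := by
    ext i j
    simp only [Matrix.of_apply, Matrix.add_apply, Pi.add_apply]
    split_ifs <;> simp
  map_smul' t x := by
    ext i j
    simp only [Matrix.of_apply, Matrix.smul_apply, Pi.smul_apply, RingHom.id_apply]
    split_ifs <;> simp

theorem symMat_apply (x : {p : Fin N × Fin N // p.1 < p.2} → ℝ) (i j : Fin N) :
    symMat N x i j =
      if h : i < j then x ⟨(i, j), h⟩ else if h : j < i then x ⟨(j, i), h⟩ else 0 := rfl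

theorem symMat_mem_Sym0 (x : {p : Fin N × Fin N // p.1 < p.2} → ℝ) : symMat N x ∈ Sym0 N := by
  refine ⟨fun i => by simp [symMat_apply], fun i j => ?_⟩
  rcases lt_trichotomy i j with h | h | h
  · simp [symMat_apply, h, h.not_gt]
  · rw [h]
  · simp [symMat_apply, h, h.not_gt]

theorem symMat_injective : Function.Injective (symMat N) := by
  intro x y h
  ext ⟨⟨i, j⟩, hij⟩
  have hij' : i < j := hij
  simpa [symMat_apply, hij'] using congrFun (congrFun h i) j

theorem symMat_upper {c : Matrix (Fin N) (Fin N) ℝ} (hc : c ∈ Sym0 N) :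
    symMat N (fun p => c p.1.1 p.1.2) = c := by
  ext i j
  rw [symMat_apply]
  rcases lt_trichotomy i j with h | h | h
  · simp [h]
  · simp [h, hc.1 j]
  · simp [h, h.not_gt, hc.2 i j]

theorem frob_symMat (x : {p : Fin N × Fin N // p.1 < p.2} → ℝ)
    (q : Matrix (Fin N) (Fin N) ℝ) : frob (symMat N x) q = x ⬝ᵥ T q := by
  have hsplit : ∀ i j, symMat N x i j * q i j =
      (if h : i < j then x ⟨(i, j), h⟩ * q i j else 0) +
        (if h : j < i then x ⟨(j, i), h⟩ * q i j else 0) := by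
    intro i j
    rcases lt_trichotomy i j with h | h | h
    · simp [symMat_apply, h, h.not_gt]
    · simp [symMat_apply, h]
    · simp [symMat_apply, h, h.not_gt]
  have hsum : ∀ g : {p : Fin N × Fin N // p.1 < p.2} → ℝ,
      ∑ i, ∑ j, (if h : i < j then g ⟨(i, j), h⟩ else 0) = ∑ p, g p := by
    intro g
    rw [← Fintype.sum_prod_type' (f := fun i j => if h : i < j then g ⟨(i, j), h⟩ else 0),
      ← Finset.sum_filter_of_ne (p := fun p : Fin N × Fin N => p.1 < p.2)
        fun p _ hp => by_contra fun h => hp (dif_neg h),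
      Finset.sum_subtype _ (p := fun p : Fin N × Fin N => p.1 < p.2) (by simp)]
    exact Finset.sum_congr rfl fun p _ => dif_pos p.2
  simp only [frob, hsplit, Finset.sum_add_distrib]
  rw [Finset.sum_comm (f := fun i j => if h : j < i then x ⟨(j, i), h⟩ * q i j else 0),
    hsum (fun p => x p * q p.1.1 p.1.2), hsum (fun p => x p * q p.1.2 p.1.1),
    ← Finset.sum_add_distrib]
  exact Finset.sum_congr rfl fun p _ => (mul_add _ _ _).symm

theorem card_upper_pairs (N : ℕ) :
    Fintype.card {p : Fin N × Fin N // p.1 < p.2} = N * (N - 1) / 2 := by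
  rw [Fintype.card_subtype, ← Finset.sum_range_id, Finset.sum_range, Finset.card_filter,
    Fintype.sum_prod_type_right]
  refine Finset.sum_congr rfl fun j _ => ?_
  rw [← Finset.card_filter, Finset.filter_gt_eq_Iio, Fin.card_Iio]

theorem continuous_frob (c : Matrix (Fin N) (Fin N) ℝ) : Continuous (frob c) := by
  unfold frob
  fun_prop

theorem convex_Plans (μ ν : Fin N → ℝ) : Convex ℝ (Plans μ ν) := by
  rintro p ⟨hp, hpr, hpc⟩ q ⟨hq, hqr, hqc⟩ a b ha hb hab
  refine ⟨fun i j => ?_, fun i => ?_, fun j => ?_⟩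
  · exact add_nonneg (mul_nonneg ha (hp i j)) (mul_nonneg hb (hq i j))
  · simp [Finset.sum_add_distrib, ← Finset.mul_sum, hpr, hqr, ← add_mul, hab]
  · simp [Finset.sum_add_distrib, ← Finset.mul_sum, hpc, hqc, ← add_mul, hab]

theorem isCompact_Plans (μ ν : Fin N → ℝ) : IsCompact (Plans μ ν) := by
  have hbox : IsCompact
      (Set.pi Set.univ fun i => Set.pi Set.univ fun _ => Set.Icc 0 (μ i) :
        Set (Matrix (Fin N) (Fin N) ℝ)) :=
    isCompact_univ_pi fun i => isCompact_univ_pi fun _ => isCompact_Icc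
  refine hbox.of_isClosed_subset ?_ ?_
  · simp only [Plans, Set.ofPred_and, Set.ofPred_forall]
    refine IsClosed.inter ?_ (IsClosed.inter ?_ ?_)
    · exact isClosed_iInter fun i => isClosed_iInter fun j =>
        isClosed_le continuous_const (by fun_prop)
    · exact isClosed_iInter fun i => isClosed_eq (by fun_prop) continuous_const
    · exact isClosed_iInter fun i => isClosed_eq (by fun_prop) continuous_const
  · rintro p ⟨hp, hpr, -⟩ i - j -
    exact ⟨hp i j, hpr i ▸ Finset.single_le_sum (fun j _ => hp i j) (Finset.mem_univ j)⟩

theorem mem_OPT_iff {c p : Matrix (Fin N) (Fin N) ℝ} {μ ν : Fin N → ℝ} :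
    p ∈ OPT c μ ν ↔ p ∈ Plans μ ν ∧ ∀ q ∈ Plans μ ν, frob c p ≤ frob c q := by
  constructor
  · rintro ⟨hp, h⟩
    refine ⟨hp, fun q hq => h ▸ csInf_le ?_ (Set.mem_image_of_mem _ hq)⟩
    exact ((isCompact_Plans μ ν).image (continuous_frob c)).bddBelow
  · rintro ⟨hp, h⟩
    refine ⟨hp, (IsLeast.csInf_eq ⟨Set.mem_image_of_mem _ hp, ?_⟩).symm⟩
    rintro _ ⟨q, hq, rfl⟩
    exact h q hq

/-- A plan minimizes a linear cost as soon as it does so among extreme points. -/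
theorem mem_OPT_of_forall_EP {c p : Matrix (Fin N) (Fin N) ℝ} {μ ν : Fin N → ℝ}
    (hp : p ∈ Plans μ ν) (h : ∀ v ∈ EP μ ν, frob c p ≤ frob c v) : p ∈ OPT c μ ν := by
  refine mem_OPT_iff.2 ⟨hp, fun q hq => ?_⟩
  have : LocallyConvexSpace ℝ (Matrix (Fin N) (Fin N) ℝ) :=
    inferInstanceAs (LocallyConvexSpace ℝ (Fin N → Fin N → ℝ))
  rw [← closure_convexHull_extremePoints (isCompact_Plans μ ν) (convex_Plans μ ν)] at hq
  have hconv : Convex ℝ {q | frob c p ≤ frob c q} :=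
    convex_halfSpace_ge (frobForm N c).isLinear _
  exact closure_minimal (convexHull_min h hconv)
    (isClosed_le continuous_const (continuous_frob c)) hq

/-- An extreme plan is determined by its support. -/
theorem eq_of_mem_EP_of_support_subset {μ ν : Fin N → ℝ} {p q : Matrix (Fin N) (Fin N) ℝ}
    (hp : p ∈ EP μ ν) (hq : q ∈ Plans μ ν) (hsupp : ∀ i j, p i j = 0 → q i j = 0) : q = p := by
  obtain ⟨⟨hp0, hpr, hpc⟩, hext⟩ := hp
  obtain ⟨hq0, hqr, hqc⟩ := hq
  have hsmall : ∀ᶠ t : ℝ in nhdsWithin 0 (Set.Ioi 0),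
      ∀ i j, 0 ≤ p i j + t * (p i j - q i j) := by
    refine Filter.eventually_all.2 fun i => Filter.eventually_all.2 fun j => ?_
    rcases (hp0 i j).eq_or_lt with h | h
    · exact Filter.Eventually.of_forall fun t => by simp [← h, hsupp i j h.symm]
    · have hlim : Filter.Tendsto (fun t : ℝ => p i j + t * (p i j - q i j))
          (nhdsWithin 0 (Set.Ioi 0)) (nhds (p i j)) := by
        refine Filter.Tendsto.mono_left (Continuous.tendsto' (by fun_prop) _ _ (by simp))
          nhdsWithin_le_nhds
      exact (hlim.eventually_const_lt h).mono fun t => le_of_lt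
  obtain ⟨t, ht, htpos⟩ := (hsmall.and self_mem_nhdsWithin).exists
  replace htpos : 0 < t := htpos
  have hmem : p + t • (p - q) ∈ Plans μ ν := by
    refine ⟨fun i j => ht i j, fun i => ?_, fun j => ?_⟩
    · simp [Finset.sum_add_distrib, ← Finset.mul_sum, hpr, hqr]
    · simp [Finset.sum_add_distrib, ← Finset.mul_sum, hpc, hqc]
  refine hext ⟨hq0, hqr, hqc⟩ hmem
    ⟨t / (1 + t), 1 / (1 + t), by positivity, by positivity, by field_simp; ring, ?_⟩
  ext i j
  simp only [Matrix.add_apply, Matrix.smul_apply, Matrix.sub_apply, smul_eq_mul]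
  field_simp
  ring

theorem finite_EP (μ ν : Fin N → ℝ) : (EP μ ν).Finite := by
  refine Set.Finite.of_injOn (f := fun p => {ij : Fin N × Fin N | p ij.1 ij.2 = 0})
    (Set.mapsTo_univ _ _) ?_ Set.finite_univ
  intro p hp q hq h
  exact eq_of_mem_EP_of_support_subset hq hp.1 fun i j hij =>
    (Set.ext_iff.1 h (i, j)).2 hij

/-- Every plan in a positive representation of an optimal plan has the same cost. -/
theorem frob_sub_eq_zero_of_represents {c p : Matrix (Fin N) (Fin N) ℝ} {μ ν : Fin N → ℝ}
    (hp : p ∈ OPT c μ ν) {n : ℕ} {v : Fin n → Matrix (Fin N) (Fin N) ℝ}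
    (hv : ∀ l, v l ∈ Plans μ ν) {lam : Fin n → ℝ} (hpos : ∀ l, 0 < lam l)
    (hsum : ∑ l, lam l = 1) (hrep : p = ∑ l, lam l • v l) (l : Fin n) :
    frob c (p - v l) = 0 := by
  have hle : ∀ l, frob c p ≤ frob c (v l) := fun l => (mem_OPT_iff.1 hp).2 _ (hv l)
  have hval : frob c p = ∑ l, lam l * frob c (v l) := by
    conv_lhs => rw [hrep, ← frobForm_apply, map_sum]
    simp [frobForm_apply]
  have hzero : ∑ l, lam l * (frob c (v l) - frob c p) = 0 := by
    simp only [mul_sub, Finset.sum_sub_distrib, ← Finset.sum_mul]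
    rw [← hval, hsum, one_mul, sub_self]
  have h := (Finset.sum_eq_zero_iff_of_nonneg fun l _ =>
    mul_nonneg (hpos l).le (sub_nonneg.2 (hle l))).1 hzero l (Finset.mem_univ l)
  have h' := (mul_eq_zero.1 h).resolve_left (hpos l).ne'
  rw [← frobForm_apply, map_sub, frobForm_apply, frobForm_apply]
  linarith

/-- The orthogonal complement of a subspace with respect to the dot product. -/
def dotAnnihilator {ι : Type*} [Fintype ι] [DecidableEq ι] (V : Submodule ℝ (ι → ℝ)) :
    Submodule ℝ (ι → ℝ) :=
  V.dualAnnihilator.map (dotProductEquiv ℝ ι).symm.toLinearMap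

theorem mem_dotAnnihilator_span {ι : Type*} [Fintype ι] [DecidableEq ι] {s : Set (ι → ℝ)}
    {x : ι → ℝ} : x ∈ dotAnnihilator (Submodule.span ℝ s) ↔ ∀ y ∈ s, x ⬝ᵥ y = 0 := by
  rw [dotAnnihilator, Submodule.mem_map_equiv, Submodule.mem_dualAnnihilator]
  refine ⟨fun h y hy => h y (Submodule.subset_span hy), fun h y hy => ?_⟩
  have hle : Submodule.span ℝ s ≤ LinearMap.ker (dotProductEquiv ℝ ι x) :=
    Submodule.span_le.2 h
  exact hle hy

theorem finrank_add_finrank_dotAnnihilator {ι : Type*} [Fintype ι] [DecidableEq ι]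
    (V : Submodule ℝ (ι → ℝ)) :
    Module.finrank ℝ V + Module.finrank ℝ (dotAnnihilator V) = Fintype.card ι := by
  rw [dotAnnihilator, LinearEquiv.finrank_map_eq, Subspace.finrank_add_finrank_dualAnnihilator_eq,
    Module.finrank_fintype_fun_eq_card]

/-- Small perturbations that are constant on the optimal face preserve optimality. -/
theorem eventually_mem_OPT_perturb {c d p : Matrix (Fin N) (Fin N) ℝ} {μ ν : Fin N → ℝ}
    (hp : p ∈ OPT c μ ν) (hd : ∀ q ∈ OPT c μ ν, frob d q = frob d p) :
    ∀ᶠ t : ℝ in nhdsWithin 0 (Set.Ioi 0), p ∈ OPT (c + t • d) μ ν := by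
  have hfrob : ∀ (t : ℝ) q, frob (c + t • d) q = frob c q + t * frob d q := fun t q => by
    simp [← frobForm_apply]
  have hp' := mem_OPT_iff.1 hp
  have h : ∀ᶠ t : ℝ in nhdsWithin 0 (Set.Ioi 0), ∀ v ∈ EP μ ν,
      frob (c + t • d) p ≤ frob (c + t • d) v := by
    refine (Filter.eventually_all_finite (finite_EP μ ν)).2 fun v hv => ?_
    by_cases hopt : v ∈ OPT c μ ν
    · refine Filter.Eventually.of_forall fun t => ?_
      rw [hfrob, hfrob, hd v hopt, hp.2, hopt.2]
    · have hlt : frob c p < frob c v := (hp'.2 v hv.1).lt_of_ne fun heq =>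
        hopt ⟨hv.1, heq ▸ hp.2⟩
      have hlim : ∀ q, Filter.Tendsto (fun t : ℝ => frob (c + t • d) q)
          (nhdsWithin 0 (Set.Ioi 0)) (nhds (frob c q)) := fun q => by
        simp only [hfrob]
        exact Filter.Tendsto.mono_left (Continuous.tendsto' (by fun_prop) _ _ (by simp))
          nhdsWithin_le_nhds
      exact ((hlim p).eventually_lt (hlim v) hlt).mono fun t => le_of_lt
  exact h.mono fun t ht => mem_OPT_of_forall_EP hp'.1 ht

end

/-- Identifiability of a symmetric cost matrix with zero diagonal from OT plans alone:
direct part (a) and converse part (b). -/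
theorem stmt16 (N K : ℕ) (hN : 1 ≤ N)
    (μ ν : Fin K → Fin N → ℝ)
    (hμ : ∀ k, μ k ∈ stdSimplex ℝ (Fin N)) (hν : ∀ k, ν k ∈ stdSimplex ℝ (Fin N))
    (hdist : Function.Injective (fun k => (μ k, ν k)))
    (c : Matrix (Fin N) (Fin N) ℝ) (hc : c ∈ Sym0 N)
    (π : Fin K → Matrix (Fin N) (Fin N) ℝ) (hπ : ∀ k, π k ∈ OPT c (μ k) (ν k))
    (L : Fin K → ℕ) (u : (k : Fin K) → Fin (L k) → Matrix (Fin N) (Fin N) ℝ)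
    (hu : ∀ k ℓ, u k ℓ ∈ EP (μ k) (ν k))
    (hrep : ∀ k, ∃ lam : Fin (L k) → ℝ,
      (∀ ℓ, 0 < lam ℓ) ∧ (∑ ℓ, lam ℓ = 1) ∧ π k = ∑ ℓ, lam ℓ • u k ℓ) :
    -- (a) direct part
    (∀ S : ℕ,
      Module.finrank ℝ (Submodule.span ℝ
          {x : {p : Fin N × Fin N // p.1 < p.2} → ℝ | ∃ k ℓ, x = T (π k - u k ℓ)}) + S =
        N * (N - 1) / 2 →
      ∃ w : Fin S → Matrix (Fin N) (Fin N) ℝ,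
        (∀ r, w r ∈ Sym0 N) ∧ LinearIndependent ℝ w ∧
        ∀ c' ∈ Sym0 N, (∀ k, π k ∈ OPT c' (μ k) (ν k)) →
          c' - c ∈ Submodule.span ℝ (Set.range w)) ∧
    -- (b) converse part
    ((∀ k, convexHull ℝ (Set.range (u k)) = OPT c (μ k) (ν k)) →
      ∀ S : ℕ,
      Module.finrank ℝ (Submodule.span ℝ
          {x : {p : Fin N × Fin N // p.1 < p.2} → ℝ | ∃ k ℓ, x = T (π k - u k ℓ)}) + S <
        N * (N - 1) / 2 →
      ∀ w : Fin S → Matrix (Fin N) (Fin N) ℝ, (∀ r, w r ∈ Sym0 N) →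
        ∃ c' ∈ Sym0 N, (∀ k, π k ∈ OPT c' (μ k) (ν k)) ∧
          c' - c ∉ Submodule.span ℝ (Set.range w)) := by
  set V := Submodule.span ℝ
    {x : {p : Fin N × Fin N // p.1 < p.2} → ℝ | ∃ k ℓ, x = T (π k - u k ℓ)} with hV
  have hdim := finrank_add_finrank_dotAnnihilator V
  rw [card_upper_pairs] at hdim
  have hmem : ∀ x, x ∈ dotAnnihilator V ↔ ∀ k ℓ, frob (symMat N x) (π k - u k ℓ) = 0 := by
    intro x
    rw [hV, mem_dotAnnihilator_span]
    constructor
    · exact fun h k ℓ => (frob_symMat _ _).trans (h _ ⟨k, ℓ, rfl⟩)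
    · rintro h _ ⟨k, ℓ, rfl⟩
      exact (frob_symMat _ _).symm.trans (h k ℓ)
  constructor
  · intro S hS
    let b := Module.finBasisOfFinrankEq ℝ (dotAnnihilator V) (n := S) (by omega)
    refine ⟨fun r => symMat N (b r), fun r => symMat_mem_Sym0 _, ?_, fun c' hc' hopt => ?_⟩
    · exact (b.linearIndependent.map' _ (Submodule.ker_subtype _)).map' _
        (LinearMap.ker_eq_bot.2 symMat_injective)
    · have hsub : c' - c ∈ Sym0 N :=
        ⟨fun i => by simp [hc.1, hc'.1], fun i j => by simp [hc.2 i j, hc'.2 i j]⟩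
      set x : {p : Fin N × Fin N // p.1 < p.2} → ℝ := fun p => (c' - c) p.1.1 p.1.2
      have hx : symMat N x = c' - c := symMat_upper hsub
      have hxA : x ∈ dotAnnihilator V := by
        refine (hmem x).2 fun k ℓ => ?_
        obtain ⟨lam, hpos, hsum, hrepk⟩ := hrep k
        rw [hx, ← frobForm_apply, map_sub (frobForm N), LinearMap.sub_apply, frobForm_apply,
          frobForm_apply,
          frob_sub_eq_zero_of_represents (hopt k) (fun l => (hu k l).1) hpos hsum hrepk ℓ,
          frob_sub_eq_zero_of_represents (hπ k) (fun l => (hu k l).1) hpos hsum hrepk ℓ, sub_zero]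
      have hspan : (⟨x, hxA⟩ : dotAnnihilator V) ∈ Submodule.span ℝ (Set.range b) := by
        rw [b.span_eq]
        trivial
      have := Submodule.mem_map_of_mem (f := symMat N ∘ₗ (dotAnnihilator V).subtype) hspan
      rw [Submodule.map_span, ← Set.range_comp] at this
      rw [← hx]
      exact this
  · intro hhull S hS w hw
    obtain ⟨x, hxA, hxw⟩ : ∃ x ∈ dotAnnihilator V,
        symMat N x ∉ Submodule.span ℝ (Set.range w) := by
      by_contra! hall
      have hle : (dotAnnihilator V).map (symMat N) ≤ Submodule.span ℝ (Set.range w) :=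
        Submodule.map_le_iff_le_comap.2 hall
      have h₁ := Submodule.finrank_mono hle
      have h₂ := finrank_range_le_card (R := ℝ) w
      rw [← (Submodule.equivMapOfInjective _ symMat_injective _).finrank_eq] at h₁
      rw [Set.finrank, Fintype.card_fin] at h₂
      omega
    have hconst : ∀ k, ∀ q ∈ OPT c (μ k) (ν k),
        frob (symMat N x) q = frob (symMat N x) (π k) := by
      intro k q hq
      rw [← hhull k] at hq
      have hconv : Convex ℝ {q | frob (symMat N x) q = frob (symMat N x) (π k)} :=
        convex_hyperplane (frobForm N (symMat N x)).isLinear _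
      refine convexHull_min ?_ hconv hq
      rintro _ ⟨ℓ, rfl⟩
      have h := (hmem x).1 hxA k ℓ
      rw [← frobForm_apply, map_sub, sub_eq_zero] at h
      exact h.symm
    obtain ⟨t, hopt, htpos⟩ := ((Filter.eventually_all.2 fun k =>
      eventually_mem_OPT_perturb (hπ k) (hconst k)).and self_mem_nhdsWithin).exists
    replace htpos : (0 : ℝ) < t := htpos
    have hx0 := symMat_mem_Sym0 x
    refine ⟨c + t • symMat N x, ⟨fun i => by simp [hc.1, hx0.1],
      fun i j => by simp [hc.2 i j, hx0.2 i j]⟩, hopt, ?_⟩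
    rwa [add_sub_cancel_left, Submodule.smul_mem_iff _ htpos.ne']
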